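/- For the KKM potential V_I, the square of the Poisson bracket C₂ = {A₂,B₂} satisfies C₂² = 2F₂, where F₂ is the cubic polynomial in the integrals given by F₂ = −8((A₁+A₂−H)(α₃A₁ + A₂(α₃+B₂) − α₃H) + δB₂² + α₂(A₂² − 4α₃δ)). -/

import Mathlib

noncomputable section

open MvPolynomial

/-- The field of rational functions over ℝ in the six variables
`x, y, z, p_x, p_y, p_z`: the fraction field of the polynomial ring. -/
abbrev K6 : Type := FractionRing (MvPolynomial (Fin 6) ℝ)

/-- The canonical embedding of the polynomial ring into its fraction field. -/
def toK6 : MvPolynomial (Fin 6) ℝ →+* K6 :=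
  algebraMap (MvPolynomial (Fin 6) ℝ) K6

/-- Constants, embedded in `K6`. -/
def cR (a : ℝ) : K6 := toK6 (MvPolynomial.C a)

def vx : K6 := toK6 (MvPolynomial.X 0)
def vy : K6 := toK6 (MvPolynomial.X 1)
def vz : K6 := toK6 (MvPolynomial.X 2)
def vpx : K6 := toK6 (MvPolynomial.X 3)
def vpy : K6 := toK6 (MvPolynomial.X 4)
def vpz : K6 := toK6 (MvPolynomial.X 5)

/-- `D` is the (unique) extension to the fraction field of the formal partial
derivative `pderiv j` on the polynomial ring: an additive map satisfying the
Leibniz rule which agrees with `pderiv j` on polynomials. -/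
def IsPDeriv (j : Fin 6) (D : K6 → K6) : Prop :=
  (∀ f g : K6, D (f + g) = D f + D g) ∧
  (∀ f g : K6, D (f * g) = D f * g + f * D g) ∧
  (∀ p, D (toK6 p) = toK6 (pderiv j p))

/-- The canonical Poisson bracket on `K6`, where `Pd 0, …, Pd 5` are the
partial derivatives with respect to `x, y, z, p_x, p_y, p_z` respectively:
`{f,g} = f_x g_{p_x} + f_y g_{p_y} + f_z g_{p_z}
  - f_{p_x} g_x - f_{p_y} g_y - f_{p_z} g_z`. -/
def poisson (Pd : Fin 6 → K6 → K6) (f g : K6) : K6 :=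
  Pd 0 f * Pd 3 g + Pd 1 f * Pd 4 g + Pd 2 f * Pd 5 g
    - Pd 3 f * Pd 0 g - Pd 4 f * Pd 1 g - Pd 5 f * Pd 2 g

/-- Angular momentum `J_x = y p_z - z p_y`. -/
def Jx : K6 := vy * vpz - vz * vpy
/-- Angular momentum `J_y = z p_x - x p_z`. -/
def Jy : K6 := vz * vpx - vx * vpz
/-- Angular momentum `J_z = x p_y - y p_x`. -/
def Jz : K6 := vx * vpy - vy * vpx
/-- Total angular momentum squared `J² = J_x² + J_y² + J_z²`. -/
def Jsq : K6 := Jx ^ 2 + Jy ^ 2 + Jz ^ 2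

/-- KKM V_I Hamiltonian. -/
def HV (α₁ α₂ α₃ δ : ℝ) : K6 :=
  vpx ^ 2 + vpy ^ 2 + vpz ^ 2 + cR δ * (vx ^ 2 + vy ^ 2 + vz ^ 2)
    + cR α₁ / vx ^ 2 + cR α₂ / vy ^ 2 + cR α₃ / vz ^ 2

def A1V (α₁ δ : ℝ) : K6 := vpx ^ 2 + cR δ * vx ^ 2 + cR α₁ / vx ^ 2

def A2V (α₃ δ : ℝ) : K6 := vpz ^ 2 + cR δ * vz ^ 2 + cR α₃ / vz ^ 2

def B1V (α₁ α₂ : ℝ) : K6 :=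
  Jz ^ 2 + cR α₂ * vx ^ 2 / vy ^ 2 + cR α₁ * vy ^ 2 / vx ^ 2

def B2V (α₂ α₃ : ℝ) : K6 :=
  Jx ^ 2 + cR α₃ * vy ^ 2 / vz ^ 2 + cR α₂ * vz ^ 2 / vy ^ 2

def FV (α₁ α₂ α₃ : ℝ) : K6 :=
  Jsq + cR α₂ * (vx ^ 2 + vz ^ 2) / vy ^ 2
    + (cR α₃ * vx ^ 2 * (vx ^ 2 + vy ^ 2) + cR α₁ * vz ^ 2 * (vy ^ 2 + vz ^ 2))
      / (vx ^ 2 * vz ^ 2)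

lemma toK6_X_ne_zero (i : Fin 6) : toK6 (X i) ≠ 0 := by
  simp [toK6]

namespace IsPDeriv

variable {j : Fin 6} {D : K6 → K6}

lemma map_add (hD : IsPDeriv j D) (f g : K6) : D (f + g) = D f + D g := hD.1 f g

lemma map_mul (hD : IsPDeriv j D) (f g : K6) : D (f * g) = D f * g + f * D g := hD.2.1 f g

lemma map_toK6_X (hD : IsPDeriv j D) (i : Fin 6) :
    D (toK6 (X i)) = if i = j then 1 else 0 := by
  rw [hD.2.2, pderiv_X, Pi.single_apply]
  split_ifs <;> simp_all

lemma map_cR (hD : IsPDeriv j D) (a : ℝ) : D (cR a) = 0 := by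
  rw [cR, hD.2.2, pderiv_C, map_zero]

lemma map_neg (hD : IsPDeriv j D) (f : K6) : D (-f) = -D f := by
  have h0 : D 0 = 0 := by simpa using hD.map_add 0 0
  have h := hD.map_add f (-f)
  rw [add_neg_cancel, h0] at h
  linear_combination -h

lemma map_sub (hD : IsPDeriv j D) (f g : K6) : D (f - g) = D f - D g := by
  rw [sub_eq_add_neg, hD.map_add, hD.map_neg, ← sub_eq_add_neg]

lemma map_sq (hD : IsPDeriv j D) (f : K6) : D (f ^ 2) = 2 * f * D f := by
  rw [pow_two, hD.map_mul]
  ring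

lemma map_div (hD : IsPDeriv j D) (f : K6) {g : K6} (hg : g ≠ 0) :
    D (f / g) = (D f * g - f * D g) / g ^ 2 := by
  have h := hD.map_mul (f / g) g
  rw [div_mul_cancel₀ f hg] at h
  rw [h]
  field_simp
  ring

/-- The partial derivatives of `A₂`. -/
lemma map_A2V (hD : IsPDeriv j D) (α₃ δ : ℝ) :
    D (A2V α₃ δ) =
      2 * vpz * D vpz + 2 * cR δ * vz * D vz - 2 * cR α₃ / vz ^ 3 * D vz := by
  have hz : vz ≠ 0 := toK6_X_ne_zero 2
  rw [A2V, hD.map_add, hD.map_add, hD.map_sq, hD.map_mul, hD.map_sq,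
    hD.map_div _ (pow_ne_zero 2 hz), hD.map_sq]
  simp only [hD.map_cR]
  field_simp
  ring

/-- The partial derivatives of `B₂`. -/
lemma map_B2V (hD : IsPDeriv j D) (α₂ α₃ : ℝ) :
    D (B2V α₂ α₃) =
      2 * Jx * (D vy * vpz + vy * D vpz - D vz * vpy - vz * D vpy)
        + 2 * cR α₃ * vy * (vz * D vy - vy * D vz) / vz ^ 3
        + 2 * cR α₂ * vz * (vy * D vz - vz * D vy) / vy ^ 3 := by
  have hy : vy ≠ 0 := toK6_X_ne_zero 1
  have hz : vz ≠ 0 := toK6_X_ne_zero 2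
  rw [B2V, hD.map_add, hD.map_add, hD.map_sq, hD.map_div _ (pow_ne_zero 2 hz),
    hD.map_div _ (pow_ne_zero 2 hy), Jx, hD.map_sub]
  simp only [hD.map_mul, hD.map_sq, hD.map_cR]
  field_simp
  ring

end IsPDeriv

/-- The bracket `{A₂, B₂}` in closed form. -/
lemma poisson_A2V_B2V {Pd : Fin 6 → K6 → K6} (hPd : ∀ j, IsPDeriv j (Pd j)) (α₂ α₃ δ : ℝ) :
    poisson Pd (A2V α₃ δ) (B2V α₂ α₃) =
      4 * Jx * (vy * (cR δ * vz - cR α₃ / vz ^ 3) + vpz * vpy)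
        + 4 * vpz * (cR α₃ * vy ^ 2 / vz ^ 3 - cR α₂ * vz / vy ^ 2) := by
  have hy : vy ≠ 0 := toK6_X_ne_zero 1
  have hz : vz ≠ 0 := toK6_X_ne_zero 2
  have hvy (j) : Pd j vy = if 1 = j then 1 else 0 := (hPd j).map_toK6_X 1
  have hvz (j) : Pd j vz = if 2 = j then 1 else 0 := (hPd j).map_toK6_X 2
  have hvpy (j) : Pd j vpy = if 4 = j then 1 else 0 := (hPd j).map_toK6_X 4
  have hvpz (j) : Pd j vpz = if 5 = j then 1 else 0 := (hPd j).map_toK6_X 5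
  simp only [poisson, (hPd _).map_A2V, (hPd _).map_B2V, hvy, hvz, hvpy, hvpz, Fin.reduceEq,
    if_true, if_false]
  field_simp
  ring

theorem kkm_VI_C2_sq (α₁ α₂ α₃ δ : ℝ) (Pd : Fin 6 → K6 → K6)
    (hPd : ∀ j, IsPDeriv j (Pd j))
    (H A1 A2 B1 B2 F : K6)
    (hH : H = HV α₁ α₂ α₃ δ) (hA1 : A1 = A1V α₁ δ) (hA2 : A2 = A2V α₃ δ)
    (hB1 : B1 = B1V α₁ α₂) (hB2 : B2 = B2V α₂ α₃) (hF : F = FV α₁ α₂ α₃) :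
    (poisson Pd A2 B2) ^ 2 =
      2 * (-8 * ((A1 + A2 - H) * (cR α₃ * A1 + A2 * (cR α₃ + B2) - cR α₃ * H)
        + cR δ * B2 ^ 2 + cR α₂ * (A2 ^ 2 - 4 * cR α₃ * cR δ))) := by
  subst hH hA1 hA2 hB2
  have hy : vy ≠ 0 := toK6_X_ne_zero 1
  have hz : vz ≠ 0 := toK6_X_ne_zero 2
  have hA : A1V α₁ δ + A2V α₃ δ - HV α₁ α₂ α₃ δ
      = -(vpy ^ 2 + cR δ * vy ^ 2 + cR α₂ / vy ^ 2) := by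
    simp only [A1V, A2V, HV]
    ring
  have hG : cR α₃ * A1V α₁ δ + A2V α₃ δ * (cR α₃ + B2V α₂ α₃) - cR α₃ * HV α₁ α₂ α₃ δ
      = A2V α₃ δ * B2V α₂ α₃ + cR α₃ * (A1V α₁ δ + A2V α₃ δ - HV α₁ α₂ α₃ δ) := by
    ring
  rw [poisson_A2V_B2V hPd, hG, hA]
  simp only [A2V, B2V, Jx]
  generalize vy = y, vz = z, vpy = p, vpz = q, cR α₂ = a, cR α₃ = b, cR δ = d at *
  field_simp
  ring
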